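/- arXiv:0708.3668 — 2 statements merged into one kernel-verified Lean document; each statement's English description precedes it below -/
import Mathlib

section
/- Let k be a field, G a group, and M a good k-linear representation of G. Then the evaluation map M → ((M^∨)^∨), sending m to the functional f ↦ f(m) on M^∨, is a G-equivariant linear isomorphism of M onto (M^∨)^∨. -/
/-!
Statement 2: for a good `k`-linear representation `M` of a group `G`, the evaluation map
`M → (M^∨)^∨`, `m ↦ (f ↦ f m)`, is a `G`-equivariant linear isomorphism of `M` onto
`(M^∨)^∨`, where `(·)^∨` denotes the `G`-finite dual.
-/

noncomputable section

variable {k G : Type} [Field k] [Group G]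

section Defs

variable {V W : Type} [AddCommGroup V] [Module k V] [AddCommGroup W] [Module k W]

/-- A submodule is a subrepresentation if it is stable under the `G`-action. -/
def IsSubrep (ρ : Representation k G V) (p : Submodule k V) : Prop :=
  ∀ (g : G), ∀ v ∈ p, ρ g v ∈ p

/-- A vector is `G`-finite if it lies in some finite-dimensional subrepresentation. -/
def IsGFiniteVector (ρ : Representation k G V) (v : V) : Prop :=
  ∃ p : Submodule k V, IsSubrep ρ p ∧ FiniteDimensional k p ∧ v ∈ p

/-- The subrepresentation of `G`-finite vectors of a representation. -/
def gFiniteVectors (ρ : Representation k G V) : Submodule k V where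
  carrier := {v | IsGFiniteVector ρ v}
  add_mem' := by
    rintro a b ⟨p, hp, hfp, hap⟩ ⟨q, hq, hfq, hbq⟩
    haveI := hfp; haveI := hfq
    refine ⟨p ⊔ q, ?_, inferInstance, Submodule.add_mem_sup hap hbq⟩
    intro g v hv
    rcases Submodule.mem_sup.mp hv with ⟨x, hx, y, hy, rfl⟩
    rw [map_add]
    exact Submodule.add_mem_sup (hp g x hx) (hq g y hy)
  zero_mem' := by
    refine ⟨⊥, ?_, inferInstance, Submodule.zero_mem ⊥⟩
    intro g v hv
    rw [Submodule.mem_bot] at hv ⊢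
    rw [hv, map_zero]
  smul_mem' := by
    rintro c v ⟨p, hp, hfp, hvp⟩
    exact ⟨p, hp, hfp, p.smul_mem c hvp⟩

lemma gFiniteVectors_isSubrep (ρ : Representation k G V) :
    IsSubrep ρ (gFiniteVectors ρ) := by
  rintro g v ⟨p, hp, hfp, hvp⟩
  exact ⟨p, hp, hfp, hp g v hvp⟩

/-- The restriction of a representation to a subrepresentation. -/
def subRep (ρ : Representation k G V) (p : Submodule k V) (hp : IsSubrep ρ p) :
    Representation k G p where
  toFun g := (ρ g).restrict (fun v hv => hp g v hv)
  map_one' := by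
    ext v
    simp [LinearMap.restrict_apply]
  map_mul' g h := by
    ext v
    simp [LinearMap.restrict_apply]

/-- The representation induced on a quotient by a subrepresentation. -/
def quotRep (ρ : Representation k G V) (p : Submodule k V) (hp : IsSubrep ρ p) :
    Representation k G (V ⧸ p) where
  toFun g := Submodule.mapQ p p (ρ g) (fun v hv => hp g v hv)
  map_one' := by
    apply Submodule.linearMap_qext
    ext v
    simp [Submodule.mapQ_apply]
  map_mul' g h := by
    apply Submodule.linearMap_qext
    ext v
    simp [Submodule.mapQ_apply]

/-- A linear map is `G`-equivariant for representations `ρ`, `σ`. -/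
def IsEquivariantMap (ρ : Representation k G V) (σ : Representation k G W)
    (f : V →ₗ[k] W) : Prop :=
  ∀ (g : G) (v : V), f (ρ g v) = σ g (f v)

/-- Two representations are isomorphic if there is an equivariant linear equivalence. -/
def IsRepIso (ρ : Representation k G V) (σ : Representation k G W) : Prop :=
  ∃ e : V ≃ₗ[k] W, ∀ (g : G) (v : V), e (ρ g v) = σ g (e v)

/-- A representation is simple (irreducible) if it is nonzero and has no nontrivial
subrepresentations. -/
def IsSimpleRep (ρ : Representation k G V) : Prop :=
  Nontrivial V ∧ ∀ p : Submodule k V, IsSubrep ρ p → p = ⊥ ∨ p = ⊤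

/-- A decomposition of a representation as an (internal) direct sum of simple
subrepresentations. -/
structure SimpleDecomposition (ρ : Representation k G V) where
  ι : Type
  c : ι → Submodule k V
  isSubrep : ∀ i, IsSubrep ρ (c i)
  indep : iSupIndep c
  total : ⨆ i, c i = ⊤
  simple : ∀ i, IsSimpleRep (subRep ρ (c i) (isSubrep i))

/-- The multiplicity of a representation `σ` in a simple decomposition: the cardinality of
the set of summands isomorphic to `σ`. -/
def SimpleDecomposition.mult {ρ : Representation k G V} (D : SimpleDecomposition ρ)
    {S : Type} [AddCommGroup S] [Module k S] (σ : Representation k G S) : Cardinal :=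
  Cardinal.mk {i : D.ι // IsRepIso (subRep ρ (D.c i) (D.isSubrep i)) σ}

/-- A representation is good if it is semisimple, every simple subrepresentation is
finite-dimensional, and every isomorphism class of simple representations occurs with
finite multiplicity. -/
def IsGoodRep (ρ : Representation k G V) : Prop :=
  Nonempty (SimpleDecomposition ρ) ∧
  (∀ (p : Submodule k V) (hp : IsSubrep ρ p),
      IsSimpleRep (subRep ρ p hp) → FiniteDimensional k p) ∧
  (∀ (D : SimpleDecomposition ρ) (S : Type) [AddCommGroup S] [Module k S]
      (σ : Representation k G S), IsSimpleRep σ →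
      {i : D.ι | IsRepIso (subRep ρ (D.c i) (D.isSubrep i)) σ}.Finite)

/-- The `G`-finite dual `V^∨` of a representation: the `G`-finite vectors of the full
linear dual. -/
abbrev gFinDual (ρ : Representation k G V) : Submodule k (Module.Dual k V) :=
  gFiniteVectors ρ.dual

/-- The representation of `G` on the `G`-finite dual. -/
abbrev gFinDualRep (ρ : Representation k G V) : Representation k G (gFinDual ρ) :=
  subRep ρ.dual (gFinDual ρ) (gFiniteVectors_isSubrep ρ.dual)

lemma IsEquivariantMap.dualMap {ρ : Representation k G V} {σ : Representation k G W}
    {f : V →ₗ[k] W} (hf : IsEquivariantMap ρ σ f) :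
    IsEquivariantMap σ.dual ρ.dual f.dualMap := by
  intro g φ
  ext v
  simp only [LinearMap.dualMap_apply, Representation.dual_apply, Module.Dual.transpose_apply,
    LinearMap.comp_apply, LinearMap.coe_comp, Function.comp_apply]
  rw [hf]

lemma map_gFiniteVectors_le {ρ : Representation k G V} {σ : Representation k G W}
    {f : V →ₗ[k] W} (hf : IsEquivariantMap ρ σ f) :
    (gFiniteVectors ρ).map f ≤ gFiniteVectors σ := by
  rintro _ ⟨v, ⟨p, hp, hfp, hvp⟩, rfl⟩
  haveI := hfp
  refine ⟨p.map f, ?_, inferInstance, Submodule.mem_map_of_mem hvp⟩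
  rintro g _ ⟨w, hw, rfl⟩
  rw [← hf]
  exact Submodule.mem_map_of_mem (hp g w hw)

/-- The map induced on `G`-finite vectors by an equivariant map. -/
def gFiniteMap (ρ : Representation k G V) (σ : Representation k G W)
    (f : V →ₗ[k] W) (hf : IsEquivariantMap ρ σ f) :
    gFiniteVectors ρ →ₗ[k] gFiniteVectors σ :=
  f.restrict (fun v hv => map_gFiniteVectors_le hf (Submodule.mem_map_of_mem hv))

lemma gFiniteMap_isEquivariant (ρ : Representation k G V) (σ : Representation k G W)
    (f : V →ₗ[k] W) (hf : IsEquivariantMap ρ σ f) :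
    IsEquivariantMap (subRep ρ _ (gFiniteVectors_isSubrep ρ))
      (subRep σ _ (gFiniteVectors_isSubrep σ)) (gFiniteMap ρ σ f hf) := by
  intro g v
  apply Subtype.ext
  exact hf g v.1

/-- The map induced on `G`-finite duals by an equivariant map (the restricted transpose). -/
abbrev gFinDualMap (ρ : Representation k G V) (σ : Representation k G W)
    (f : V →ₗ[k] W) (hf : IsEquivariantMap ρ σ f) :
    gFinDual σ →ₗ[k] gFinDual ρ :=
  gFiniteMap σ.dual ρ.dual f.dualMap hf.dualMap

lemma gFinDualMap_isEquivariant (ρ : Representation k G V) (σ : Representation k G W)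
    (f : V →ₗ[k] W) (hf : IsEquivariantMap ρ σ f) :
    IsEquivariantMap (V := gFinDual σ) (W := gFinDual ρ)
      (gFinDualRep σ) (gFinDualRep ρ) (gFinDualMap ρ σ f hf) :=
  gFiniteMap_isEquivariant σ.dual ρ.dual f.dualMap hf.dualMap


/-- The evaluation map `M → ((M^∨))*`, sending `m` to the functional `f ↦ f (m)` on the
`G`-finite dual `M^∨`. -/
def gFinDualEval (ρ : Representation k G V) : V →ₗ[k] Module.Dual k (gFinDual ρ) :=
  (gFinDual ρ).subtype.dualMap ∘ₗ Module.Dual.eval k V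

lemma schur_aux {ρ : Representation k G V} {σ : Representation k G W}
    (hρ : IsSimpleRep ρ) (hσ : IsSimpleRep σ) (f : V →ₗ[k] W)
    (hf : IsEquivariantMap ρ σ f) (h0 : f ≠ 0) : IsRepIso ρ σ := by
  have hk : LinearMap.ker f = ⊥ := by
    rcases hρ.2 (LinearMap.ker f) (by
      intro g v hv
      rw [LinearMap.mem_ker] at hv ⊢
      rw [hf, hv, map_zero]) with h | h
    · exact h
    · exact absurd (LinearMap.ker_eq_top.mp h) h0
  have hr : LinearMap.range f = ⊤ := by
    rcases hσ.2 (LinearMap.range f) (by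
      rintro g _ ⟨v, rfl⟩
      exact ⟨ρ g v, hf g v⟩) with h | h
    · exact absurd (LinearMap.range_eq_bot.mp h) h0
    · exact h
  exact ⟨LinearEquiv.ofBijective f ⟨LinearMap.ker_eq_bot.mp hk, LinearMap.range_eq_top.mp hr⟩,
    fun g v => hf g v⟩

lemma IsRepIso.symm_aux {ρ : Representation k G V} {σ : Representation k G W}
    (h : IsRepIso ρ σ) : IsRepIso σ ρ := by
  obtain ⟨e, he⟩ := h
  refine ⟨e.symm, fun g v => ?_⟩
  rw [LinearEquiv.symm_apply_eq, he, LinearEquiv.apply_symm_apply]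

lemma simple_le_or_disjoint {ρ : Representation k G V} {p : Submodule k V} {hp : IsSubrep ρ p}
    (hs : IsSimpleRep (subRep ρ p hp)) {q : Submodule k V} (hq : IsSubrep ρ q) :
    p ⊓ q = ⊥ ∨ p ≤ q := by
  rcases hs.2 (q.comap p.subtype) (fun g v hv => hq g v.1 hv) with h | h
  · left
    rw [eq_bot_iff]
    rintro x ⟨hx, hxq⟩
    have : (⟨x, hx⟩ : p) ∈ q.comap p.subtype := hxq
    rw [h, Submodule.mem_bot] at this
    simpa using congrArg Subtype.val this
  · right
    intro x hx
    have : (⟨x, hx⟩ : p) ∈ q.comap p.subtype := by rw [h]; trivial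
    exact this

lemma isSubrep_sup {ρ : Representation k G V} {p q : Submodule k V} (hp : IsSubrep ρ p)
    (hq : IsSubrep ρ q) : IsSubrep ρ (p ⊔ q) := by
  intro g v hv
  rcases Submodule.mem_sup.mp hv with ⟨x, hx, y, hy, rfl⟩
  rw [map_add]
  exact Submodule.add_mem_sup (hp g x hx) (hq g y hy)

lemma isSubrep_iSup {ρ : Representation k G V} {ι : Sort*} {c : ι → Submodule k V}
    (hc : ∀ i, IsSubrep ρ (c i)) : IsSubrep ρ (⨆ i, c i) := by
  intro g v hv
  change v ∈ (⨆ i, c i).comap (ρ g)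
  exact (iSup_le fun i x hx => Submodule.mem_iSup_of_mem i (hc i g x hx) :
    (⨆ i, c i) ≤ (⨆ i, c i).comap (ρ g)) hv

lemma isSubrep_finset_sup {ρ : Representation k G V} {ι : Type} {c : ι → Submodule k V}
    (hc : ∀ i, IsSubrep ρ (c i)) (J : Finset ι) : IsSubrep ρ (J.sup c) := by
  rw [Finset.sup_eq_iSup]
  exact isSubrep_iSup fun i => isSubrep_iSup fun _ => hc i

/-- A simple subrepresentation inside `N + C` but not inside `N` is isomorphic to `C`. -/
lemma iso_of_le_sup {ρ : Representation k G V} {T C N : Submodule k V}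
    {hT : IsSubrep ρ T} {hC : IsSubrep ρ C} (hN : IsSubrep ρ N)
    (sT : IsSimpleRep (subRep ρ T hT)) (sC : IsSimpleRep (subRep ρ C hC))
    (hle : T ≤ N ⊔ C) (hn : ¬ T ≤ N) : IsRepIso (subRep ρ T hT) (subRep ρ C hC) := by
  have hCN : C ⊓ N = ⊥ := (simple_le_or_disjoint sC hN).resolve_right fun h =>
    hn (hle.trans (sup_le le_rfl h))
  have hinj : LinearMap.ker (N.mkQ ∘ₗ C.subtype) = ⊥ := by
    rw [eq_bot_iff]
    intro x hx
    have hx' : (x : V) ∈ N := by simpa using hx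
    have : (x : V) ∈ C ⊓ N := ⟨x.2, hx'⟩
    rw [hCN, Submodule.mem_bot] at this
    rw [Submodule.mem_bot]
    exact Subtype.ext this
  obtain ⟨l, hl⟩ := LinearMap.exists_leftInverse_of_injective _ hinj
  have hl' : ∀ (c : C) (n : V), n ∈ N → l (N.mkQ (n + c)) = c := by
    intro c n hn
    have h1 : N.mkQ n = 0 := by simpa using hn
    rw [map_add, h1, zero_add]
    exact LinearMap.congr_fun hl c
  have key : ∀ t : T, ∃ n ∈ N, ∃ c : C, (t : V) = n + c := by
    intro t
    obtain ⟨n, hn, c, hc, h⟩ := Submodule.mem_sup.mp (hle t.2)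
    exact ⟨n, hn, ⟨c, hc⟩, h.symm⟩
  refine schur_aux sT sC (l ∘ₗ N.mkQ ∘ₗ T.subtype) ?_ ?_
  · intro g t
    obtain ⟨n, hn, c, h⟩ := key t
    have e1 : ((subRep ρ T hT g t : T) : V) = ρ g n + (subRep ρ C hC g c : C) := by
      change ρ g t = ρ g n + ρ g c
      rw [h, map_add]
    simp only [LinearMap.comp_apply, Submodule.subtype_apply]
    rw [e1, h, hl' _ _ hn, hl' _ _ (hN g n hn)]
  · intro h0
    apply hn
    intro t ht
    obtain ⟨n, hn, c, h⟩ := key ⟨t, ht⟩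
    have h1 := LinearMap.congr_fun h0 ⟨t, ht⟩
    simp only [LinearMap.comp_apply, Submodule.subtype_apply, LinearMap.zero_apply] at h1
    simp only at h
    rw [h, hl' _ _ hn] at h1
    rw [h, h1]
    simpa using hn

lemma iso_of_le_finset_sup {ρ : Representation k G V} {ι : Type} {c : ι → Submodule k V}
    (hc : ∀ i, IsSubrep ρ (c i)) (hs : ∀ i, IsSimpleRep (subRep ρ (c i) (hc i)))
    {N : Submodule k V} (hN : IsSubrep ρ N) (i : ι) (hn : ¬ c i ≤ N) (J : Finset ι) :
    c i ≤ N ⊔ J.sup c → ∃ j ∈ J, IsRepIso (subRep ρ (c i) (hc i)) (subRep ρ (c j) (hc j)) := by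
  classical
  induction J using Finset.induction_on with
  | empty => intro h; simp at h; exact absurd h hn
  | insert j J hj ih =>
    intro h
    by_cases h' : c i ≤ N ⊔ J.sup c
    · obtain ⟨a, ha, e⟩ := ih h'
      exact ⟨a, Finset.mem_insert_of_mem ha, e⟩
    · refine ⟨j, Finset.mem_insert_self _ _, ?_⟩
      refine iso_of_le_sup (isSubrep_sup hN (isSubrep_finset_sup hc J)) (hs i) (hs j) ?_ h'
      rw [Finset.sup_insert] at h
      rwa [sup_assoc, sup_comm (J.sup c)]

/-- A finite-codimensional subrepresentation contains almost all the simple summands. -/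
lemma finite_not_le {ρ : Representation k G V} {ι : Type} {c : ι → Submodule k V}
    (hc : ∀ i, IsSubrep ρ (c i)) (hs : ∀ i, IsSimpleRep (subRep ρ (c i) (hc i)))
    (htot : ⨆ i, c i = ⊤)
    (hfin : ∀ j, {i | IsRepIso (subRep ρ (c i) (hc i)) (subRep ρ (c j) (hc j))}.Finite)
    {N : Submodule k V} (hN : IsSubrep ρ N) [FiniteDimensional k (V ⧸ N)] :
    {i | ¬ c i ≤ N}.Finite := by
  obtain ⟨C, hC⟩ := Submodule.exists_isCompl N
  haveI : FiniteDimensional k C :=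
    LinearEquiv.finiteDimensional (Submodule.quotientEquivOfIsCompl N C hC)
  have hcpt := (Submodule.fg_iff_compact C).mp (Module.Finite.iff_fg.mp this)
  obtain ⟨J, hJ⟩ := CompleteLattice.IsCompactElement.exists_finset_of_le_iSup _ hcpt c
    (by rw [htot]; exact le_top)
  refine Set.Finite.subset (J.finite_toSet.biUnion (fun j _ => hfin j)) ?_
  intro i hi
  obtain ⟨j, hj, e⟩ := iso_of_le_finset_sup hc hs hN i hi J (by
    rw [Finset.sup_eq_iSup]
    refine le_trans le_top ?_
    rw [← hC.sup_eq_top]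
    exact sup_le_sup le_rfl hJ)
  exact Set.mem_biUnion hj e

/-- Dual version of `iso_of_le_sup`. -/
lemma iso_of_inf_ker_le {S T : Type} [AddCommGroup S] [Module k S] [AddCommGroup T] [Module k T]
    {ρ : Representation k G V} {σ : Representation k G S} {τ : Representation k G T}
    (hσ : IsSimpleRep σ) (hτ : IsSimpleRep τ) (a : V →ₗ[k] S) (b : V →ₗ[k] T)
    (ha : IsEquivariantMap ρ σ a) (hb : IsEquivariantMap ρ τ b)
    {L : Submodule k V} (hL : IsSubrep ρ L)
    (hle : LinearMap.ker b ⊓ L ≤ LinearMap.ker a) (hn : ¬ L ≤ LinearMap.ker a) :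
    IsRepIso τ σ := by
  have hsurj : L.map b = ⊤ := by
    rcases hτ.2 (L.map b) (by
      rintro g _ ⟨v, hv, rfl⟩
      exact ⟨ρ g v, hL g v hv, hb g v⟩) with h | h
    · exfalso
      apply hn
      intro x hx
      refine hle ⟨?_, hx⟩
      have : b x ∈ L.map b := Submodule.mem_map_of_mem hx
      rwa [h, Submodule.mem_bot] at this
    · exact h
  have hr : LinearMap.range (b ∘ₗ L.subtype) = ⊤ := by
    rw [LinearMap.range_comp, Submodule.range_subtype, hsurj]
  obtain ⟨r, hr⟩ := LinearMap.exists_rightInverse_of_surjective _ hr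
  have hr' : ∀ t, b (r t : V) = t := fun t => LinearMap.congr_fun hr t
  have key : ∀ x y : V, x ∈ L → y ∈ L → b x = b y → a x = a y := by
    intro x y hx hy h
    have : x - y ∈ LinearMap.ker a := hle ⟨by simp [h], L.sub_mem hx hy⟩
    rw [LinearMap.mem_ker, map_sub] at this
    exact sub_eq_zero.mp this
  refine schur_aux hτ hσ (a ∘ₗ L.subtype ∘ₗ r) ?_ ?_
  · intro g t
    simp only [LinearMap.comp_apply, Submodule.subtype_apply]
    rw [← ha]
    apply key _ _ (r _).2 (hL g _ (r t).2)
    rw [hb, hr', hr']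
  · intro h0
    apply hn
    intro x hx
    have := LinearMap.congr_fun h0 (b x)
    simp only [LinearMap.comp_apply, Submodule.subtype_apply, LinearMap.zero_apply] at this
    rw [LinearMap.mem_ker, ← this]
    exact key _ _ hx (r _).2 (hr' _).symm

lemma finite_ne_zero {ρ : Representation k G V} [FiniteDimensional k V] {ι : Type}
    {S : ι → Type} [∀ i, AddCommGroup (S i)] [∀ i, Module k (S i)]
    {σ : ∀ i, Representation k G (S i)} (hs : ∀ i, IsSimpleRep (σ i))
    (hfin : ∀ j, {i | IsRepIso (σ i) (σ j)}.Finite)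
    (a : ∀ i, V →ₗ[k] S i) (ha : ∀ i, IsEquivariantMap ρ (σ i) (a i)) :
    {i | a i ≠ 0}.Finite := by
  classical
  have main : ∀ (i : ι), a i ≠ 0 → ∀ J : Finset ι,
      J.inf (fun j => LinearMap.ker (a j)) ≤ LinearMap.ker (a i) →
      ∃ j ∈ J, IsRepIso (σ i) (σ j) := by
    intro i hi J
    induction J using Finset.induction_on with
    | empty =>
      intro h
      rw [Finset.inf_empty, top_le_iff] at h
      exact absurd (LinearMap.ker_eq_top.mp h) hi
    | insert j J hj ih =>
      intro h
      by_cases h' : J.inf (fun j => LinearMap.ker (a j)) ≤ LinearMap.ker (a i)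
      · obtain ⟨b, hb, e⟩ := ih h'
        exact ⟨b, Finset.mem_insert_of_mem hb, e⟩
      · refine ⟨j, Finset.mem_insert_self _ _, ?_⟩
        rw [Finset.inf_insert] at h
        refine (iso_of_inf_ker_le (hs i) (hs j) (a i) (a j) (ha i) (ha j) ?_ h h').symm_aux
        intro g v hv
        rw [Submodule.mem_finsetInf] at hv ⊢
        intro b hb
        have := hv b hb
        rw [LinearMap.mem_ker] at this ⊢
        rw [ha b, this, map_zero]
  obtain ⟨J, hJ⟩ := Finset.exists_inf_le (fun j => LinearMap.ker (a j))
  refine Set.Finite.subset (J.finite_toSet.biUnion (fun j _ => hfin j)) ?_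
  intro i hi
  obtain ⟨j, hj, e⟩ := main i hi J (hJ i)
  exact Set.mem_biUnion hj e

lemma gFinDual_vanish {ρ : Representation k G V} {ι : Type} {c : ι → Submodule k V}
    (hc : ∀ i, IsSubrep ρ (c i)) (hs : ∀ i, IsSimpleRep (subRep ρ (c i) (hc i)))
    (htot : ⨆ i, c i = ⊤)
    (hfin : ∀ j, {i | IsRepIso (subRep ρ (c i) (hc i)) (subRep ρ (c j) (hc j))}.Finite)
    (f : gFinDual ρ) : {i | ¬ c i ≤ LinearMap.ker f.1}.Finite := by
  obtain ⟨f, p, hp, hfp, hf⟩ := f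
  haveI := Subspace.finiteDimensional_quot_dualCoannihilator_iff.mpr hfp
  refine (finite_not_le hc hs htot hfin (N := p.dualCoannihilator) ?_).subset ?_
  · intro g v hv
    rw [Submodule.mem_dualCoannihilator] at hv ⊢
    intro φ hφ
    have := hv _ (hp g⁻¹ φ hφ)
    simpa [Representation.dual_apply, Module.Dual.transpose_apply] using this
  · intro i hi h
    apply hi
    intro x hx
    exact (Submodule.mem_dualCoannihilator _).mp (h hx) f hf

/-- A functional killing a subrepresentation of finite codimension is `G`-finite. -/
lemma mem_gFinDual {ρ : Representation k G V} {A B : Submodule k V} (hA : IsSubrep ρ A)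
    [FiniteDimensional k B] (hAB : A ⊔ B = ⊤) (f : Module.Dual k V)
    (hf : A ≤ LinearMap.ker f) : f ∈ gFinDual ρ := by
  have hq : FiniteDimensional k (V ⧸ A) := by
    refine Module.Finite.of_surjective (A.mkQ ∘ₗ B.subtype) ?_
    rw [← LinearMap.range_eq_top, LinearMap.range_comp, Submodule.range_subtype]
    have h1 : (A ⊔ B).map A.mkQ = ⊤ := by
      rw [hAB, Submodule.map_top, Submodule.range_mkQ]
    rw [Submodule.map_sup] at h1
    simpa using h1
  refine ⟨A.dualAnnihilator, ?_, ?_, ?_⟩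
  · intro g φ hφ
    rw [Submodule.mem_dualAnnihilator] at hφ ⊢
    intro w hw
    exact hφ _ (hA g⁻¹ w hw)
  · exact LinearEquiv.finiteDimensional A.dualQuotEquivDualAnnihilator
  · rw [Submodule.mem_dualAnnihilator]
    exact fun w hw => hf hw

/-- For a good representation `M` of `G`, the evaluation map
`m ↦ (f ↦ f m)` is `G`-equivariant, injective, and has image exactly the double
`G`-finite dual `(M^∨)^∨ ⊆ (M^∨)*`; that is, it is a `G`-equivariant isomorphism of `M`
onto `(M^∨)^∨`. -/
theorem gFinDualEval_isRepIso_onto_double_gFinDual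
    {M : Type} [AddCommGroup M] [Module k M] (ρ : Representation k G M)
    (hgood : IsGoodRep ρ) :
    (∀ (g : G) (m : M),
        gFinDualEval ρ (ρ g m) = (gFinDualRep ρ).dual g (gFinDualEval ρ m)) ∧
      Function.Injective (gFinDualEval ρ) ∧
      LinearMap.range (gFinDualEval ρ) = gFinDual (V := gFinDual ρ) (gFinDualRep ρ) := by
  classical
  obtain ⟨⟨D⟩, hfd, hmul⟩ := hgood
  have hequiv : ∀ (g : G) (m : M),
      gFinDualEval ρ (ρ g m) = (gFinDualRep ρ).dual g (gFinDualEval ρ m) := by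
    intro g m
    ext f
    change f.1 (ρ g m) = f.1 (ρ (g⁻¹)⁻¹ m)
    rw [inv_inv]
  haveI hfdi : ∀ i, FiniteDimensional k (D.c i) := fun i => hfd _ (D.isSubrep i) (D.simple i)
  have hfin : ∀ j, {i | IsRepIso (subRep ρ (D.c i) (D.isSubrep i))
      (subRep ρ (D.c j) (D.isSubrep j))}.Finite := fun j => hmul D _ _ (D.simple j)
  have hJfd : ∀ J : Finset D.ι, FiniteDimensional k (⨆ i ∈ J, D.c i : Submodule k M) := by
    intro J
    rw [← Finset.sup_eq_iSup]
    exact Submodule.finiteDimensional_finset_sup J D.c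
  refine ⟨hequiv, ?_, le_antisymm ?_ ?_⟩
  · rw [← LinearMap.ker_eq_bot, eq_bot_iff]
    intro m hm
    by_contra hm0
    have hmt : m ∈ ⨆ i, D.c i := by rw [D.total]; trivial
    obtain ⟨J, hJ⟩ := Submodule.mem_iSup_iff_exists_finset.mp hmt
    have hdis : Disjoint (⨆ i ∈ (J : Set D.ι), D.c i) (⨆ i ∈ ((J : Set D.ι)ᶜ), D.c i) :=
      D.indep.disjoint_biSup_biSup disjoint_compl_right
    have hmA : m ∉ ⨆ i ∈ ((J : Set D.ι)ᶜ), D.c i := by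
      intro h
      exact hm0 (Submodule.disjoint_def.mp hdis m (by simpa using hJ) h)
    obtain ⟨f, hfm, hfA⟩ := Submodule.exists_le_ker_of_notMem hmA
    have hfG : f ∈ gFinDual ρ := by
      refine mem_gFinDual (B := ⨆ i ∈ J, D.c i)
        (isSubrep_iSup fun i => isSubrep_iSup fun _ => D.isSubrep i) ?_ f hfA
      rw [eq_top_iff, ← D.total]
      refine iSup_le fun i => ?_
      by_cases hi : i ∈ J
      · exact le_sup_of_le_right (le_iSup₂_of_le i hi le_rfl)
      · exact le_sup_of_le_left (le_iSup₂_of_le i (by simpa using hi) le_rfl)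
    exact hfm (LinearMap.congr_fun (LinearMap.mem_ker.mp hm) ⟨f, hfG⟩)
  · rintro _ ⟨m, rfl⟩
    have hmt : m ∈ ⨆ i, D.c i := by rw [D.total]; trivial
    obtain ⟨J, hJ⟩ := Submodule.mem_iSup_iff_exists_finset.mp hmt
    refine map_gFiniteVectors_le (f := gFinDualEval ρ) hequiv (Submodule.mem_map_of_mem ?_)
    exact ⟨⨆ i ∈ J, D.c i, isSubrep_iSup fun i => isSubrep_iSup fun _ => D.isSubrep i,
      hJfd J, hJ⟩
  · rintro φ ⟨P, hP, hPf, hφ⟩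
    have hcompl : ∀ i, IsCompl (D.c i) (⨆ j, ⨆ (_ : j ≠ i), D.c j) := by
      intro i
      refine ⟨D.indep i, ?_⟩
      rw [codisjoint_iff, eq_top_iff, ← D.total]
      refine iSup_le fun j => ?_
      by_cases h : j = i
      · subst h; exact le_sup_left
      · exact le_sup_of_le_right (le_iSup₂_of_le j h le_rfl)
    let pr : ∀ i, M →ₗ[k] D.c i := fun i => (D.c i).projectionOnto _ (hcompl i)
    have pr_self : ∀ i (x : D.c i), pr i x = x := fun i x =>
      Submodule.projectionOnto_apply_left (hcompl i) x
    have pr_ne : ∀ i j, j ≠ i → ∀ x ∈ D.c j, pr i x = 0 := fun i j h x hx =>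
      Submodule.projectionOnto_apply_of_mem_right (hcompl i)
        (Submodule.mem_iSup_of_mem j (Submodule.mem_iSup_of_mem h hx))
    have hind : ∀ (motive : M → Prop), (∀ i, ∀ x ∈ D.c i, motive x) → motive 0 →
        (∀ x y, motive x → motive y → motive (x + y)) → ∀ x, motive x := by
      intro motive h1 h2 h3 x
      exact Submodule.iSup_induction D.c (motive := motive) (x := x)
        (by rw [D.total]; trivial) h1 h2 h3
    have pr_eq : ∀ i (g : G) (m : M),
        pr i (ρ g m) = subRep ρ (D.c i) (D.isSubrep i) g (pr i m) := by
      intro i g m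
      refine hind (fun m => pr i (ρ g m) = subRep ρ (D.c i) (D.isSubrep i) g (pr i m))
        ?_ ?_ ?_ m
      · intro j x hx
        by_cases h : j = i
        · subst h
          have h1 := pr_self j ⟨x, hx⟩
          have h2 := pr_self j ⟨ρ g x, D.isSubrep j g x hx⟩
          simp only at h1 h2
          rw [h1, h2]
          rfl
        · rw [pr_ne i j h x hx, pr_ne i j h _ (D.isSubrep j g x hx), map_zero]
      · simp
      · intro x y hx hy
        simp only [map_add, hx, hy]
    -- extension by zero of functionals
    have hext : ∀ i (f : Module.Dual k (D.c i)), f ∘ₗ pr i ∈ gFinDual ρ := by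
      intro i f
      refine mem_gFinDual (A := ⨆ j, ⨆ (_ : j ≠ i), D.c j) (B := D.c i)
        (isSubrep_iSup fun i => isSubrep_iSup fun _ => D.isSubrep i) ?_ _ ?_
      · rw [sup_comm]; exact (hcompl i).sup_eq_top
      · refine iSup_le fun j => iSup_le fun h x hx => ?_
        rw [LinearMap.mem_ker, LinearMap.comp_apply, pr_ne i j h x hx, map_zero]
    let E : ∀ i, Module.Dual k (D.c i) →ₗ[k] gFinDual ρ := fun i =>
      (pr i).dualMap.codRestrict (gFinDual ρ) (hext i)
    let a : ∀ i, P →ₗ[k] D.c i := fun i =>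
      (Module.evalEquiv k (D.c i)).symm.toLinearMap ∘ₗ (E i).dualMap ∘ₗ P.subtype
    have ha : ∀ i (ψ : P) (f : Module.Dual k (D.c i)), f (a i ψ) = ψ.1 (E i f) := by
      intro i ψ f
      have : Module.evalEquiv k (D.c i) (a i ψ) = (E i).dualMap ψ.1 := by
        simp [a]
      exact LinearMap.congr_fun this f
    have haeq : ∀ i, IsEquivariantMap (subRep (gFinDualRep ρ).dual P hP)
        (subRep ρ (D.c i) (D.isSubrep i)) (a i) := by
      intro i g ψ
      rw [← sub_eq_zero, ← Module.forall_dual_apply_eq_zero_iff k]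
      intro f
      rw [map_sub, sub_eq_zero, ha]
      have h2 := ha i ψ (f ∘ₗ subRep ρ (D.c i) (D.isSubrep i) g)
      rw [LinearMap.comp_apply] at h2
      rw [h2]
      change ψ.1 (gFinDualRep ρ g⁻¹ (E i f)) = _
      congr 1
      apply Subtype.ext
      ext m
      change f (pr i (ρ (g⁻¹)⁻¹ m)) = f (subRep ρ (D.c i) (D.isSubrep i) g (pr i m))
      rw [inv_inv, pr_eq]
    haveI hPf' : FiniteDimensional k P := hPf
    have hafin : {i | a i ≠ 0}.Finite :=
      finite_ne_zero (V := P) (S := fun i => D.c i) (ρ := subRep (gFinDualRep ρ).dual P hP)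
        (σ := fun i => subRep ρ (D.c i) (D.isSubrep i)) (fun i => D.simple i) hfin a haeq
    refine ⟨∑ i ∈ hafin.toFinset, (a i ⟨φ, hφ⟩ : M), ?_⟩
    ext f
    have hffin := gFinDual_vanish D.isSubrep D.simple D.total hfin f
    have hfdec : f = ∑ i ∈ hafin.toFinset ∪ hffin.toFinset, E i (f.1 ∘ₗ (D.c i).subtype) := by
      apply Subtype.ext
      ext m
      rw [AddSubmonoidClass.coe_finset_sum, LinearMap.sum_apply]
      refine hind (fun m => f.1 m = ∑ i ∈ hafin.toFinset ∪ hffin.toFinset,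
        (E i (f.1 ∘ₗ (D.c i).subtype)).1 m) ?_ ?_ ?_ m
      · intro j x hx
        have hE : ∀ i, (E i (f.1 ∘ₗ (D.c i).subtype)).1 x = f.1 (pr i x) := fun i => rfl
        simp only [hE]
        have hself : ((pr j x : D.c j) : M) = x := congrArg Subtype.val (pr_self j ⟨x, hx⟩)
        rw [Finset.sum_eq_single j]
        · rw [hself]
        · intro i _ hij
          rw [pr_ne i j (Ne.symm hij) x hx]
          simp
        · intro hj
          have : D.c j ≤ LinearMap.ker f.1 := by
            by_contra hcon
            exact hj (Finset.mem_union_right _ (hffin.mem_toFinset.mpr hcon))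
          rw [hself]
          exact this hx
      · simp
      · intro x y hx hy
        simp only [map_add, Finset.sum_add_distrib, hx, hy]
    have hR : φ f = ∑ i ∈ hafin.toFinset ∪ hffin.toFinset, f.1 (a i ⟨φ, hφ⟩ : M) := by
      conv_lhs => rw [hfdec]
      rw [map_sum]
      refine Finset.sum_congr rfl fun i _ => ?_
      exact (ha i ⟨φ, hφ⟩ (f.1 ∘ₗ (D.c i).subtype)).symm
    rw [hR]
    change f.1 (∑ i ∈ hafin.toFinset, (a i ⟨φ, hφ⟩ : M)) = _
    rw [map_sum]
    refine Finset.sum_subset Finset.subset_union_left fun i _ hi => ?_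
    have : a i = 0 := by
      by_contra hcon
      exact hi (hafin.mem_toFinset.mpr hcon)
    rw [this]
    simp

end Defs

end
end

section
/- Let k be a field, G a group, and let A and B be k-linear representations of G such that every vector of A is G-finite. Suppose A and B carry finite filtrations by subrepresentations 0 = A^{-1} ⊆ A^0 ⊆ ⋯ ⊆ A^N = A and 0 = B^{-1} ⊆ B^0 ⊆ ⋯ ⊆ B^N = B, and let j : A → B be a G-equivariant linear map with j(A^p) ⊆ B^p for each p. If for every p the induced map A^p/A^{p−1} → B^p/B^{p−1} is injective with image exactly the subrepresentation (B^p/B^{p−1})_fin of G-finite vectors, then j is injective and its image is exactly B_fin, the subrepresentation of G-finite vectors of B; that is, j : A → B_fin is an isomorphism. -/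
/-!
Statement 6: let `A`, `B` be `k`-linear representations of a group `G` such that every
vector of `A` is `G`-finite, equipped with finite filtrations by subrepresentations
`0 = A⁻¹ ⊆ A⁰ ⊆ ⋯ ⊆ Aᴺ = A` and `0 = B⁻¹ ⊆ B⁰ ⊆ ⋯ ⊆ Bᴺ = B` (here re-indexed as
`F 0 = 0 ⊆ F 1 ⊆ ⋯ ⊆ F (N+1) = ⊤`), and let `j : A → B` be a `G`-equivariant filtered
linear map. If each induced graded map `Aᵖ/Aᵖ⁻¹ → Bᵖ/Bᵖ⁻¹` is injective with image
exactly the `G`-finite vectors of `Bᵖ/Bᵖ⁻¹`, then `j` is injective with image exactly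
`B_fin`; i.e. `j : A → B_fin` is an isomorphism.
-/

noncomputable section

variable {k G : Type} [Field k] [Group G]

section Defs

variable {V W : Type} [AddCommGroup V] [Module k V] [AddCommGroup W] [Module k W]

lemma comap_subtype_isSubrep {ρ : Representation k G V} {p q : Submodule k V}
    (hp : IsSubrep ρ p) (hq : IsSubrep ρ q) :
    IsSubrep (subRep ρ q hq) (p.comap q.subtype) := by
  intro g v hv
  exact hp g v.1 hv

/-- The graded piece `F (p+1) / F p` of a filtration by subrepresentations, as a
representation of `G`. -/
def gradedRep (ρ : Representation k G V) (F : ℕ → Submodule k V)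
    (hF : ∀ n, IsSubrep ρ (F n)) (p : ℕ) :
    Representation k G (↥(F (p + 1)) ⧸ ((F p).comap (F (p + 1)).subtype)) :=
  quotRep (subRep ρ (F (p + 1)) (hF (p + 1))) ((F p).comap (F (p + 1)).subtype)
    (comap_subtype_isSubrep (hF p) (hF (p + 1)))

/-- The map induced on graded pieces by a filtered linear map. -/
def gradedMap (FA : ℕ → Submodule k V) (FB : ℕ → Submodule k W) (j : V →ₗ[k] W)
    (hjF : ∀ p, ∀ v ∈ FA p, j v ∈ FB p) (p : ℕ) :
    (↥(FA (p + 1)) ⧸ ((FA p).comap (FA (p + 1)).subtype)) →ₗ[k]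
      (↥(FB (p + 1)) ⧸ ((FB p).comap (FB (p + 1)).subtype)) :=
  Submodule.mapQ _ _ (j.restrict (fun v hv => hjF (p + 1) v hv))
    (fun v hv => hjF p v.1 hv)

/-- Let `j : A → B` be an equivariant filtered map between filtered
representations, where every vector of `A` is `G`-finite, the filtrations are finite
(`F 0 = ⊥`, `F (N+1) = ⊤`) and by subrepresentations. If each graded map
`Aᵖ/Aᵖ⁻¹ → Bᵖ/Bᵖ⁻¹` is injective with image exactly the `G`-finite vectors of
`Bᵖ/Bᵖ⁻¹`, then `j` is injective with image exactly the `G`-finite vectors of `B`. -/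
theorem filtered_map_injective_range_gFiniteVectors
    {A B : Type} [AddCommGroup A] [Module k A] [AddCommGroup B] [Module k B]
    (ρA : Representation k G A) (ρB : Representation k G B)
    (hAfin : ∀ v : A, IsGFiniteVector ρA v)
    (N : ℕ) (FA : ℕ → Submodule k A) (FB : ℕ → Submodule k B)
    (hFA : ∀ n, IsSubrep ρA (FA n)) (hFB : ∀ n, IsSubrep ρB (FB n))
    (hmonoA : Monotone FA) (hmonoB : Monotone FB)
    (hA0 : FA 0 = ⊥) (hB0 : FB 0 = ⊥)
    (hAtop : FA (N + 1) = ⊤) (hBtop : FB (N + 1) = ⊤)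
    (j : A →ₗ[k] B) (hj : IsEquivariantMap ρA ρB j)
    (hjF : ∀ p, ∀ v ∈ FA p, j v ∈ FB p)
    (hgraded : ∀ p, Function.Injective (gradedMap FA FB j hjF p) ∧
      LinearMap.range (gradedMap FA FB j hjF p) =
        gFiniteVectors (gradedRep ρB FB hFB p)) :
    Function.Injective j ∧ LinearMap.range j = gFiniteVectors ρB := by
  have hfinA : ∀ a, j a ∈ gFiniteVectors ρB := fun a =>
    map_gFiniteVectors_le hj (Submodule.mem_map_of_mem (hAfin a))
  have hmk : ∀ p (v : FA (p + 1)), gradedMap FA FB j hjF p (Submodule.Quotient.mk v) =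
      Submodule.Quotient.mk ⟨j v.1, hjF (p + 1) v.1 v.2⟩ := fun p v => rfl
  have hinj : ∀ p, ∀ v ∈ FA p, j v = 0 → v = 0 := by
    intro p
    induction p with
    | zero =>
      intro v hv _
      rw [hA0] at hv
      simpa using hv
    | succ p ih =>
      intro v hv h0
      refine ih v ?_ h0
      have h1 : gradedMap FA FB j hjF p (Submodule.Quotient.mk ⟨v, hv⟩) = 0 := by
        rw [hmk, Submodule.Quotient.mk_eq_zero]
        change j v ∈ FB p
        rw [h0]
        exact zero_mem _
      have h2 := (hgraded p).1 (h1.trans (map_zero _).symm)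
      rw [Submodule.Quotient.mk_eq_zero] at h2
      exact h2
  have hsurj : ∀ p, ∀ b ∈ FB p, b ∈ gFiniteVectors ρB → b ∈ LinearMap.range j := by
    intro p
    induction p with
    | zero =>
      intro b hb _
      rw [hB0, Submodule.mem_bot] at hb
      rw [hb]
      exact zero_mem _
    | succ p ih =>
      intro b hb hfin
      have h1 : (⟨b, hb⟩ : FB (p + 1)) ∈
          gFiniteVectors (subRep ρB (FB (p + 1)) (hFB (p + 1))) := by
        obtain ⟨P, hP, hfP, hbP⟩ := hfin
        haveI := hfP
        refine ⟨P.comap (FB (p + 1)).subtype, comap_subtype_isSubrep hP _, ?_, hbP⟩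
        exact FiniteDimensional.of_injective
          ((FB (p + 1)).subtype.restrict (p := P.comap (FB (p + 1)).subtype) (q := P)
            (fun v hv => hv))
          (fun x y h => Subtype.ext (Subtype.ext (congrArg (fun z : P => (z : B)) h)))
      have heq : IsEquivariantMap (subRep ρB (FB (p + 1)) (hFB (p + 1)))
          (gradedRep ρB FB hFB p) (Submodule.mkQ _) := fun g v => rfl
      have h2 := map_gFiniteVectors_le heq (Submodule.mem_map_of_mem h1)
      rw [← (hgraded p).2] at h2
      obtain ⟨q, hq⟩ := h2
      obtain ⟨a, rfl⟩ := Submodule.Quotient.mk_surjective _ q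
      rw [hmk, Submodule.mkQ_apply, eq_comm, Submodule.Quotient.eq] at hq
      have h3 : b - j a.1 ∈ FB p := hq
      have h4 := ih _ h3 (sub_mem hfin (hfinA _))
      have h5 := add_mem h4 (LinearMap.mem_range_self j a.1)
      rwa [sub_add_cancel] at h5
  refine ⟨(injective_iff_map_eq_zero j).2 fun v hv =>
    hinj (N + 1) v (hAtop ▸ Submodule.mem_top) hv, le_antisymm ?_ ?_⟩
  · rintro _ ⟨a, rfl⟩
    exact hfinA a
  · intro b hb
    exact hsurj (N + 1) b (hBtop ▸ Submodule.mem_top) hb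

end Defs

end
end
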